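/- arXiv:2510.24417 — 8 statements merged into one kernel-verified Lean document; each statement's English description precedes it below -/
import Mathlib

section
/- Let X be a Banach space, T : X → X a Fréchet differentiable map, and x̄ ∈ X. Suppose Y₀ ≥ 0 satisfies ‖T(x̄) − x̄‖ ≤ Y₀, and Z : (0,∞) → [0,∞) satisfies, for every r > 0, sup over x in the closed ball of radius r about x̄ of ‖DT(x)‖ ≤ Z(r) (operator norm of the Fréchet derivative). If there exists r₀ > 0 such that Z(r₀)·r₀ − r₀ + Y₀ < 0, then there exists a unique x⋆ in the closed ball of radius r₀ about x̄ with T(x⋆) = x⋆. -/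
/-- **Radii polynomial / Newton–Kantorovich contraction theorem.**
If `T : X → X` is Fréchet differentiable on a Banach space `X`, `‖T x̄ - x̄‖ ≤ Y₀`,
`Z r` bounds the operator norm of the derivative of `T` on the closed ball of radius `r`
about `x̄` for every `r > 0`, and the radii polynomial `Z(r₀)·r₀ - r₀ + Y₀` is negative for
some `r₀ > 0`, then `T` has a unique fixed point in the closed ball of radius `r₀` about `x̄`. -/
theorem radii_polynomial_contraction
    {X : Type*} [NormedAddCommGroup X] [NormedSpace ℝ X] [CompleteSpace X]
    (T : X → X) (DT : X → X →L[ℝ] X)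
    (hT : ∀ x : X, HasFDerivAt T (DT x) x)
    (xbar : X) (Y₀ : ℝ) (hY₀ : 0 ≤ Y₀)
    (hY : ‖T xbar - xbar‖ ≤ Y₀)
    (Z : ℝ → ℝ) (hZnonneg : ∀ r : ℝ, 0 < r → 0 ≤ Z r)
    (hZ : ∀ r : ℝ, 0 < r → ∀ x ∈ Metric.closedBall xbar r, ‖DT x‖ ≤ Z r)
    (r₀ : ℝ) (hr₀ : 0 < r₀)
    (hp : Z r₀ * r₀ - r₀ + Y₀ < 0) :
    ∃! x : X, x ∈ Metric.closedBall xbar r₀ ∧ T x = x := by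
  have hxbar : xbar ∈ Metric.closedBall xbar r₀ := Metric.mem_closedBall_self hr₀.le
  have hZ0 : 0 ≤ Z r₀ := hZnonneg r₀ hr₀
  have hZ1 : Z r₀ < 1 := by nlinarith
  have hlip : ∀ x ∈ Metric.closedBall xbar r₀, ∀ y ∈ Metric.closedBall xbar r₀,
      dist (T x) (T y) ≤ Z r₀ * dist x y := fun x hx y hy => by
    simpa only [dist_eq_norm] using
      (convex_closedBall xbar r₀).norm_image_sub_le_of_norm_hasFDerivWithin_le
        (fun z _ => (hT z).hasFDerivWithinAt) (hZ r₀ hr₀) hy hx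
  have hmaps : Set.MapsTo T (Metric.closedBall xbar r₀) (Metric.closedBall xbar r₀) := by
    intro x hx
    have h₁ := hlip x hx xbar hxbar
    rw [Metric.mem_closedBall] at hx ⊢
    rw [← dist_eq_norm] at hY
    have h₂ := mul_le_mul_of_nonneg_left hx hZ0
    linarith [dist_triangle (T x) (T xbar) xbar]
  have hcontr : ContractingWith (Z r₀).toNNReal (hmaps.restrict T _ _) := by
    refine ⟨Real.toNNReal_lt_one.2 hZ1, LipschitzWith.of_dist_le_mul fun x y => ?_⟩
    rw [Real.coe_toNNReal _ hZ0]
    exact hlip x x.2 y y.2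
  obtain ⟨x, hx, hfix, -⟩ := ContractingWith.exists_fixedPoint'
    Metric.isClosed_closedBall.isComplete hmaps hcontr hxbar (edist_ne_top _ _)
  refine ⟨x, ⟨hx, hfix⟩, fun y ⟨hy, hyfix⟩ => ?_⟩
  exact congrArg Subtype.val <| hcontr.fixedPoint_unique' (x := ⟨y, hy⟩) (y := ⟨x, hx⟩)
    (Subtype.ext hyfix) (Subtype.ext hfix)
end

section
/- Let n, m be natural numbers with m ≤ n, let G : ℝⁿ → ℝⁿ be continuously differentiable, and let Φ : ℝ × ℝⁿ → ℝⁿ be a global flow for G, i.e. Φ(0,U) = U and ∂ₓΦ(x,U) = G(Φ(x,U)) for all x ∈ ℝ, U ∈ ℝⁿ. Let μ₁,…,μₘ < 0 be real numbers, let Ωˢ = diag(μ₁,…,μₘ), let δ > 0, let B_δ = {σ ∈ ℝᵐ : max_i |σ_i| < δ}, and let P : B_δ → ℝⁿ be continuously differentiable. Then the following are equivalent: (1) for all σ ∈ B_δ and all x ≥ 0, Φ(x, P(σ)) = P(e^{Ωˢx}σ); (2) for all σ ∈ B_δ, G(P(σ)) = DP(σ)(Ωˢσ), where DP(σ) is the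 (total) derivative of P at σ. -/
open Set in
/-- Two solutions on `[0, ∞)` of an autonomous ODE with `C¹` right-hand side which agree at `0`
agree on `[0, ∞)`. -/
theorem eqOn_Ici_of_hasDerivAt_of_contDiff {E : Type*} [NormedAddCommGroup E] [NormedSpace ℝ E]
    {G : E → E} (hG : ContDiff ℝ 1 G) {f g : ℝ → E}
    (hf : ∀ t, 0 ≤ t → HasDerivAt f (G (f t)) t) (hg : ∀ t, 0 ≤ t → HasDerivAt g (G (g t)) t)
    (h0 : f 0 = g 0) : EqOn f g (Ici 0) := by
  intro x hx
  have hfc : ContinuousOn f (Icc 0 x) := fun t ht => (hf t ht.1).continuousAt.continuousWithinAt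
  have hgc : ContinuousOn g (Icc 0 x) := fun t ht => (hg t ht.1).continuousAt.continuousWithinAt
  have hcpt : IsCompact (f '' Icc 0 x ∪ g '' Icc 0 x) :=
    (isCompact_Icc.image_of_continuousOn hfc).union (isCompact_Icc.image_of_continuousOn hgc)
  obtain ⟨K, hK⟩ :=
    (hG.locallyLipschitz.locallyLipschitzOn (s := f '' Icc 0 x ∪ g '' Icc 0 x)
      ).exists_lipschitzOnWith_of_compact hcpt
  exact ODE_solution_unique_of_mem_Icc_right (v := fun _ => G)
    (s := fun _ => f '' Icc 0 x ∪ g '' Icc 0 x) (fun _ _ => hK)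
    hfc (fun t ht => (hf t ht.1).hasDerivWithinAt)
    (fun t ht => Or.inl (mem_image_of_mem f (Ico_subset_Icc_self ht)))
    hgc (fun t ht => (hg t ht.1).hasDerivWithinAt)
    (fun t ht => Or.inr (mem_image_of_mem g (Ico_subset_Icc_self ht))) h0 ⟨hx, le_rfl⟩

/-- The curve `x ↦ diag(e^{μ₁ x}, …, e^{μₘ x}) σ` solves the linear equation `σ' = diag(μ) σ`. -/
theorem hasDerivAt_exp_mul_pi {ι : Type*} [Fintype ι] (μ σ : ι → ℝ) (x : ℝ) :
    HasDerivAt (fun t : ℝ => fun i => Real.exp (μ i * t) * σ i)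
      (fun i => μ i * (Real.exp (μ i * x) * σ i)) x := by
  refine hasDerivAt_pi.2 fun i => ?_
  have h := (((hasDerivAt_id x).const_mul (μ i)).exp).mul_const (σ i)
  refine h.congr_deriv ?_
  simp only [id]
  ring

theorem abs_exp_mul_mul_lt {a x s δ : ℝ} (ha : a ≤ 0) (hx : 0 ≤ x) (hs : |s| < δ) :
    |Real.exp (a * x) * s| < δ := by
  rw [abs_mul, Real.abs_exp]
  have h : Real.exp (a * x) ≤ 1 := Real.exp_le_one_iff.2 (mul_nonpos_of_nonpos_of_nonneg ha hx)
  exact (mul_le_of_le_one_left (abs_nonneg s) h).trans_lt hs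

/-- **Parameterization-method lemma for invariant manifolds (Lemma `param lemma manifolds`).**
Let `Φ` be a global flow of the `C¹` vector field `G : ℝⁿ → ℝⁿ`, let `μ₁,…,μₘ < 0`,
`Ωˢ = diag(μ₁,…,μₘ)`, and let `P` be continuously differentiable on
`B_δ = {σ : max_i |σ i| < δ}`. Then `Φ(x, P σ) = P (e^{Ωˢ x} σ)` for all `σ ∈ B_δ`, `x ≥ 0`,
iff `G (P σ) = DP σ (Ωˢ σ)` for all `σ ∈ B_δ`. -/
theorem parameterization_lemma_manifolds
    {n m : ℕ} (hmn : m ≤ n)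
    (G : (Fin n → ℝ) → (Fin n → ℝ)) (hG : ContDiff ℝ 1 G)
    (Φ : ℝ → (Fin n → ℝ) → (Fin n → ℝ))
    (hΦ0 : ∀ U, Φ 0 U = U)
    (hΦ : ∀ (x : ℝ) (U : Fin n → ℝ), HasDerivAt (fun t => Φ t U) (G (Φ x U)) x)
    (μ : Fin m → ℝ) (hμ : ∀ i, μ i < 0)
    (δ : ℝ) (hδ : 0 < δ)
    (P : (Fin m → ℝ) → (Fin n → ℝ))
    (DP : (Fin m → ℝ) → ((Fin m → ℝ) →L[ℝ] (Fin n → ℝ)))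
    (hP : ∀ σ : Fin m → ℝ, (∀ i, |σ i| < δ) → HasFDerivAt P (DP σ) σ)
    (hDPcont : ContinuousOn DP {σ : Fin m → ℝ | ∀ i, |σ i| < δ}) :
    (∀ σ : Fin m → ℝ, (∀ i, |σ i| < δ) → ∀ x : ℝ, 0 ≤ x →
        Φ x (P σ) = P fun i => Real.exp (μ i * x) * σ i)
      ↔
    (∀ σ : Fin m → ℝ, (∀ i, |σ i| < δ) →
        G (P σ) = DP σ fun i => μ i * σ i) := by
  have hcurve : ∀ σ : Fin m → ℝ, (∀ i, |σ i| < δ) → ∀ x : ℝ, 0 ≤ x →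
      HasDerivAt (fun t : ℝ => P fun i => Real.exp (μ i * t) * σ i)
        (DP (fun i => Real.exp (μ i * x) * σ i) fun i => μ i * (Real.exp (μ i * x) * σ i)) x :=
    fun σ hσ x hx =>
      (hP _ fun i => abs_exp_mul_mul_lt (hμ i).le hx (hσ i)).comp_hasDerivAt x
        (hasDerivAt_exp_mul_pi μ σ x)
  constructor
  · intro h σ hσ
    have hflow := (hΦ 0 (P σ)).hasDerivWithinAt (s := Set.Ici 0)
    have hpar := (hcurve σ hσ 0 le_rfl).hasDerivWithinAt (s := Set.Ici 0)
    have heq := (uniqueDiffOn_Ici (0 : ℝ) 0 Set.self_mem_Ici).eq_deriv _ hflow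
      (hpar.congr (h σ hσ) (h σ hσ 0 le_rfl))
    simpa [hΦ0] using heq
  · intro h σ hσ x hx
    refine eqOn_Ici_of_hasDerivAt_of_contDiff hG (f := fun t => Φ t (P σ))
      (g := fun t => P fun i => Real.exp (μ i * t) * σ i) (fun t _ => hΦ t (P σ))
      (fun t ht => ?_) (by simp [hΦ0]) hx
    rw [h _ fun i => abs_exp_mul_mul_lt (hμ i).le ht (hσ i)]
    exact hcurve σ hσ t ht
end

section
/- Let G : ℝⁿ → ℝⁿ be continuously differentiable, let μ₁,…,μₘ < 0 be real, Ωˢ = diag(μ₁,…,μₘ), δ > 0, B_δ = {σ ∈ ℝᵐ : max_i |σ_i| < δ}, let P : B_δ → ℝⁿ be continuous, let 𝒜 : B_δ → Mₙ(ℝ) be continuous, and let 𝒲 : B_δ → Mₙ(ℝ) be continuously differentiable. Then the following are equivalent: (1) for all σ ∈ B_δ, DG(P(σ)) 𝒲(σ) = D𝒲(σ)(Ωˢσ) + 𝒲(σ)𝒜(σ), where D𝒲(σ)(Ωˢσ) denotes the directional derivative of 𝒲 at σ in the direction Ωˢσ; (2) for every σ ∈ B_δ and every differentiable M̃ : [0,∞)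 → Mₙ(ℝ) with M̃(0) = I and M̃'(x) = 𝒜(e^{Ωˢx}σ) M̃(x) for all x ≥ 0, the map M(x) := 𝒲(e^{Ωˢx}σ) M̃(x) satisfies M(0) = 𝒲(σ) and M'(x) = DG(P(e^{Ωˢx}σ)) M(x) for all x ≥ 0. -/
/-- A linear differential equation with continuous, bounded coefficients has a solution on
`[0, ∞)` for every initial value. -/
theorem exists_hasDerivAt_linear_of_bounded {E : Type*} [NormedAddCommGroup E] [NormedSpace ℝ E]
    [CompleteSpace E] {a : ℝ → E →L[ℝ] E} (ha : Continuous a) {K : ℝ} (hK : ∀ t, ‖a t‖ ≤ K)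
    (y₀ : E) :
    ∃ y : ℝ → E, y 0 = y₀ ∧ ∀ t, 0 ≤ t → HasDerivAt y (a t (y t)) t := by
  obtain ⟨k, hk0, hk⟩ : ∃ k : ℝ, 0 < k ∧ ∀ t, ‖a t‖ ≤ k :=
    ⟨max K 1, by positivity, fun t => (hK t).trans (le_max_left _ _)⟩
  let g : (BoundedContinuousFunction ℝ E) → ℝ → E := fun u s => Real.exp (2 * k * s) • a s (u s)
  have hg : ∀ u, Continuous (g u) := fun u =>
    (by fun_prop : Continuous fun s : ℝ => Real.exp (2 * k * s)).smul (ha.clm_apply u.continuous)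
  let J : (BoundedContinuousFunction ℝ E) → ℝ → E := fun u t => ∫ s in (0 : ℝ)..t, g u s
  have hJ : ∀ u t, HasDerivAt (J u) (g u t) t := fun u t =>
    intervalIntegral.integral_hasDerivAt_right ((hg u).intervalIntegrable _ _)
      (hg u).aestronglyMeasurable.stronglyMeasurableAtFilter (hg u).continuousAt
  have hJc : ∀ u, Continuous (J u) := fun u =>
    continuous_iff_continuousAt.2 fun t => (hJ u t).continuousAt
  have hJsub : ∀ u v t, J u t - J v t = J (u - v) t := by
    intro u v t
    simp only [J]
    rw [← intervalIntegral.integral_sub ((hg u).intervalIntegrable _ _)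
      ((hg v).intervalIntegrable _ _)]
    simp [g, smul_sub]
  have hJb : ∀ u t, 0 ≤ t → ‖Real.exp (-(2 * k * t)) • J u t‖ ≤ ‖u‖ / 2 := by
    intro u t ht
    have hint : ∫ s in (0 : ℝ)..t, Real.exp (2 * k * s) * (k * ‖u‖)
        = (Real.exp (2 * k * t) - 1) * (‖u‖ / 2) := by
      rw [intervalIntegral.integral_mul_const,
        intervalIntegral.integral_comp_mul_left (fun s => Real.exp s) (by positivity), integral_exp]
      simp
      field_simp
    have h1 : ‖J u t‖ ≤ (Real.exp (2 * k * t) - 1) * (‖u‖ / 2) := by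
      rw [← hint]
      refine intervalIntegral.norm_integral_le_of_norm_le ht (.of_forall fun s _ => ?_)
        (Continuous.intervalIntegrable (by fun_prop) _ _)
      rw [norm_smul, Real.norm_of_nonneg (Real.exp_pos _).le]
      gcongr
      exact (a s).le_of_opNorm_le_of_le (hk s) (u.norm_coe_le_norm s)
    rw [norm_smul, Real.norm_of_nonneg (Real.exp_pos _).le, Real.exp_neg,
      inv_mul_le_iff₀ (Real.exp_pos _)]
    nlinarith [norm_nonneg u]
  have hJb' : ∀ u t, ‖Real.exp (-(2 * k * max t 0)) • J u (max t 0)‖ ≤ ‖u‖ / 2 := fun u t =>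
    hJb u _ (le_max_right _ _)
  let T : (BoundedContinuousFunction ℝ E) → (BoundedContinuousFunction ℝ E) := fun u =>
    BoundedContinuousFunction.ofNormedAddCommGroup
      (fun t => Real.exp (-(2 * k * max t 0)) • (y₀ + J u (max t 0)))
      (by have := hJc u; fun_prop) (‖y₀‖ + ‖u‖ / 2) (fun t => by
        rw [smul_add]
        refine (norm_add_le _ _).trans (add_le_add ?_ (hJb' u t))
        rw [norm_smul, Real.norm_of_nonneg (Real.exp_pos _).le]
        refine mul_le_of_le_one_left (norm_nonneg _) (Real.exp_le_one_iff.2 ?_)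
        have := le_max_right t 0
        nlinarith)
  have hT : ContractingWith (1 / 2) T := by
    refine ⟨by norm_num, LipschitzWith.of_dist_le_mul fun u v => ?_⟩
    rw [dist_eq_norm, dist_eq_norm]
    refine (BoundedContinuousFunction.norm_le (by positivity)).2 fun t => ?_
    have : (T u - T v) t = Real.exp (-(2 * k * max t 0)) • J (u - v) (max t 0) := by
      rw [← hJsub, smul_sub]
      simp [T]
    rw [this]
    refine (hJb' _ t).trans (le_of_eq ?_)
    push_cast
    ring
  let u := hT.fixedPoint T
  have hu : T u = u := hT.fixedPoint_isFixedPt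
  refine ⟨fun t => y₀ + J u t, by simp [J], fun t ht => ?_⟩
  have hut : u t = Real.exp (-(2 * k * t)) • (y₀ + J u t) := by
    conv_lhs => rw [← hu]
    simp [T, max_eq_left ht]
  convert (hJ u t).const_add y₀ using 1
  simp only [g]
  rw [hut, map_smul, smul_smul, ← Real.exp_add]
  simp

/-- The flow of a diagonal linear system with negative rates does not increase coordinates. -/
theorem abs_exp_mul_le_abs {μ x : ℝ} (hμ : μ < 0) (hx : 0 ≤ x) (s : ℝ) :
    |Real.exp (μ * x) * s| ≤ |s| := by
  rw [abs_mul, Real.abs_exp]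
  exact mul_le_of_le_one_left (abs_nonneg _)
    (Real.exp_le_one_iff.2 (mul_nonpos_of_nonpos_of_nonneg hμ.le hx))


/-- **Conjugacy lemma for resonant vector bundles (Lemma `L:conjugacy`).**
Let `G` be `C¹`, `μ₁,…,μₘ < 0`, `Ωˢ = diag(μ₁,…,μₘ)`, `P` continuous on `B_δ`, `𝒜` continuous
on `B_δ`, and `𝒲` continuously differentiable on `B_δ` (all matrix/operator valued). Then the
bundle conjugacy equation `DG(P σ) 𝒲(σ) = D𝒲(σ)(Ωˢ σ) + 𝒲(σ)𝒜(σ)` on `B_δ` holds iff for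
every `σ ∈ B_δ` and every solution `M̃` on `[0,∞)` of `M̃' = 𝒜(e^{Ωˢ x} σ) M̃`, `M̃(0) = I`,
the map `M(x) = 𝒲(e^{Ωˢ x} σ) M̃(x)` satisfies `M(0) = 𝒲(σ)` and
`M' = DG(P(e^{Ωˢ x} σ)) M` on `[0,∞)`. -/
theorem bundle_conjugacy_lemma
    {n m : ℕ}
    (G : (Fin n → ℝ) → (Fin n → ℝ)) (hG : ContDiff ℝ 1 G)
    (μs : Fin m → ℝ) (hμs : ∀ i, μs i < 0)
    (δ : ℝ) (hδ : 0 < δ)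
    (P : (Fin m → ℝ) → (Fin n → ℝ))
    (hPcont : ContinuousOn P {σ : Fin m → ℝ | ∀ i, |σ i| < δ})
    (𝒜 : (Fin m → ℝ) → ((Fin n → ℝ) →L[ℝ] (Fin n → ℝ)))
    (h𝒜cont : ContinuousOn 𝒜 {σ : Fin m → ℝ | ∀ i, |σ i| < δ})
    (𝒲 : (Fin m → ℝ) → ((Fin n → ℝ) →L[ℝ] (Fin n → ℝ)))
    (D𝒲 : (Fin m → ℝ) → ((Fin m → ℝ) →L[ℝ] ((Fin n → ℝ) →L[ℝ] (Fin n → ℝ))))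
    (h𝒲 : ∀ σ : Fin m → ℝ, (∀ i, |σ i| < δ) → HasFDerivAt 𝒲 (D𝒲 σ) σ)
    (hD𝒲cont : ContinuousOn D𝒲 {σ : Fin m → ℝ | ∀ i, |σ i| < δ}) :
    (∀ σ : Fin m → ℝ, (∀ i, |σ i| < δ) →
        (fderiv ℝ G (P σ)).comp (𝒲 σ) =
          D𝒲 σ (fun i => μs i * σ i) + (𝒲 σ).comp (𝒜 σ))
      ↔
    (∀ σ : Fin m → ℝ, (∀ i, |σ i| < δ) →
      ∀ Mt : ℝ → ((Fin n → ℝ) →L[ℝ] (Fin n → ℝ)),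
        Mt 0 = ContinuousLinearMap.id ℝ (Fin n → ℝ) →
        (∀ x ∈ Set.Ici (0 : ℝ), HasDerivWithinAt Mt
          ((𝒜 fun i => Real.exp (μs i * x) * σ i).comp (Mt x)) (Set.Ici 0) x) →
        ((𝒲 fun i => Real.exp (μs i * (0 : ℝ)) * σ i).comp (Mt 0) = 𝒲 σ ∧
         ∀ x ∈ Set.Ici (0 : ℝ), HasDerivWithinAt
           (fun t : ℝ => (𝒲 fun i => Real.exp (μs i * t) * σ i).comp (Mt t))
           ((fderiv ℝ G (P fun i => Real.exp (μs i * x) * σ i)).comp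
             ((𝒲 fun i => Real.exp (μs i * x) * σ i).comp (Mt x)))
           (Set.Ici 0) x)) := by
  set B : Set (Fin m → ℝ) := {σ | ∀ i, |σ i| < δ}
  let φ : (Fin m → ℝ) → ℝ → Fin m → ℝ := fun σ x i => Real.exp (μs i * x) * σ i
  have hφ0 : ∀ σ, φ σ 0 = σ := fun σ => by ext; simp [φ]
  have hφB : ∀ σ ∈ B, ∀ x, 0 ≤ x → φ σ x ∈ B := fun σ hσ x hx i =>
    (abs_exp_mul_le_abs (hμs i) hx _).trans_lt (hσ i)
  have hφ' : ∀ σ x, HasDerivAt (φ σ) (fun i => μs i * φ σ x i) x := by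
    intro σ x
    refine hasDerivAt_pi.2 fun i => ?_
    refine (((hasDerivAt_id x).const_mul (μs i)).exp.mul_const (σ i)).congr_deriv ?_
    simp only [φ, id]
    ring
  have hderiv : ∀ σ ∈ B, ∀ Mt : ℝ → ((Fin n → ℝ) →L[ℝ] (Fin n → ℝ)), ∀ x, 0 ≤ x →
      HasDerivWithinAt Mt ((𝒜 (φ σ x)).comp (Mt x)) (Set.Ici 0) x →
      HasDerivWithinAt (fun t => (𝒲 (φ σ t)).comp (Mt t))
        ((D𝒲 (φ σ x) (fun i => μs i * φ σ x i) + (𝒲 (φ σ x)).comp (𝒜 (φ σ x))).comp (Mt x))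
        (Set.Ici 0) x := by
    intro σ hσ Mt x hx hM
    have hW := (h𝒲 _ (hφB σ hσ x hx)).comp_hasDerivWithinAt x
      (hφ' σ x).hasDerivWithinAt (s := Set.Ici 0)
    rw [ContinuousLinearMap.add_comp]
    exact hW.clm_comp hM
  constructor
  · intro h σ hσ Mt hM0 hM
    refine ⟨?_, fun x hx => ?_⟩
    · rw [hM0, ContinuousLinearMap.comp_id]
      exact congrArg 𝒲 (hφ0 σ)
    · have := hderiv σ hσ Mt x hx (hM x hx)
      rwa [← h _ (hφB σ hσ x hx)] at this
  · intro h σ hσ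
    let a : ℝ → (Fin n → ℝ) →L[ℝ] (Fin n → ℝ) := fun t => 𝒜 (φ σ (max t 0))
    have hac : Continuous a :=
      h𝒜cont.comp_continuous
        ((continuous_iff_continuousAt.2 fun x => (hφ' σ x).continuousAt).comp (by fun_prop))
        fun t => hφB σ hσ _ (le_max_right _ _)
    let c := ContinuousLinearMap.compL ℝ (Fin n → ℝ) (Fin n → ℝ) (Fin n → ℝ)
    let S : Set (Fin m → ℝ) := Set.univ.pi fun i => Set.Icc (-|σ i|) |σ i|
    have hSB : S ⊆ B := fun τ hτ i => (abs_le.2 (hτ i trivial)).trans_lt (hσ i)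
    obtain ⟨K, hK⟩ := (isCompact_univ_pi fun i => isCompact_Icc).exists_bound_of_continuousOn
      (c.continuous.comp_continuousOn (h𝒜cont.mono hSB))
    obtain ⟨Mt, hM0, hM⟩ := exists_hasDerivAt_linear_of_bounded (c.continuous.comp hac)
      (K := K) (fun t => hK _ fun i _ => abs_le.1
        (abs_exp_mul_le_abs (hμs i) (le_max_right t 0) _)) (ContinuousLinearMap.id ℝ _)
    have hM' : ∀ x ∈ Set.Ici (0 : ℝ),
        HasDerivWithinAt Mt ((𝒜 (φ σ x)).comp (Mt x)) (Set.Ici 0) x := fun x hx => by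
      have := (hM x hx).hasDerivWithinAt (s := Set.Ici 0)
      simpa [a, c, max_eq_left (Set.mem_Ici.1 hx)] using this
    have h0 := (h σ hσ Mt hM0 hM').2 0 Set.self_mem_Ici
    have h1 := hderiv σ hσ Mt 0 le_rfl (hM' 0 Set.self_mem_Ici)
    have := (uniqueDiffOn_Ici (0 : ℝ) 0 Set.self_mem_Ici).eq_deriv _ h0 h1
    change (fderiv ℝ G (P (φ σ 0))).comp ((𝒲 (φ σ 0)).comp (Mt 0)) = _ at this
    simpa only [hφ0, hM0, ContinuousLinearMap.comp_id] using this
end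

section
/- Let n, m ∈ ℕ with 1 ≤ m ≤ n, and let μ₁ < μ₂ < … < μₘ < 0 < μ_{m+1} < … < μₙ be real numbers; write Ω = diag(μ₁,…,μₙ) and, for α ∈ ℕᵐ, write α·μ = α₁μ₁ + … + αₘμₘ and |α| = α₁ + … + αₘ. For 1 ≤ i,j ≤ n let Res_{i,j} = {α ∈ ℕᵐ : |α| ≥ 1 and α·μ + μⱼ − μᵢ = 0}. Let 𝒲₀ ∈ Mₙ(ℝ) be invertible, and let Ĝ : ℕᵐ → Mₙ(ℝ) be any family with Ĝ₀ = 𝒲₀ Ω 𝒲₀⁻¹. Define families 𝒲, 𝒜 : ℕᵐ → Mₙ(ℝ) by strong recursion on |α| as follows: 𝒲 at index 0 equals 𝒲₀ and 𝒜 at index 0 equals Ω; for |α| ≥ 1, set S_α = Ĝ_α 𝒲₀ + (Ĝ ∗̂ 𝒲)_α − (𝒲 ∗̂ 𝒜)_α, set S̃_α = 𝒲₀⁻¹ S_α, and define the matrix W̃_α entrywise by W̃_α^{i,j} = S̃_α^{i,j} / (α·μ + μⱼ − μᵢ) if α ∉ Res_{i,j} and W̃_α^{i,j} = 0 if α ∈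 Res_{i,j}; define 𝒜_α entrywise by 𝒜_α^{i,j} = S̃_α^{i,j} if α ∈ Res_{i,j} and 𝒜_α^{i,j} = 0 otherwise; finally set 𝒲_α = 𝒲₀ W̃_α. Then: (a) for every α ∈ ℕᵐ, (α·μ)𝒲_α + (𝒲 ∗ 𝒜)_α = (Ĝ ∗ 𝒲)_α; (b) 𝒜_α^{i,j} = 0 whenever i > j; (c) 𝒜_α^{i,j} = 0 whenever |α| > (μᵢ − μⱼ)/μₘ. -/
open scoped Classical

/-- The order `|α| = α₁ + ⋯ + αₘ` of a multi-index. -/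
def multiOrder {m : ℕ} (α : Fin m → ℕ) : ℕ := ∑ i, α i

/-- `α · μ = α₁ μ₁ + ⋯ + αₘ μₘ`, the first `m` eigenvalues paired with a multi-index. -/
noncomputable def multiDot {m n : ℕ} (hmn : m ≤ n) (μ : Fin n → ℝ) (α : Fin m → ℕ) : ℝ :=
  ∑ i, (α i : ℝ) * μ (Fin.castLE hmn i)

/-- The finite set of multi-indices `β ≤ α` (componentwise). -/
def multiBelow {m : ℕ} (α : Fin m → ℕ) : Finset (Fin m → ℕ) :=
  Fintype.piFinset fun i => Finset.Iic (α i)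

/-- Cauchy product of matrix-valued families: `(b ∗ b̃)_α = Σ_{β ≤ α} b_{α−β} b̃_β`. -/
def cauchyProd {m n : ℕ} (b b' : (Fin m → ℕ) → Matrix (Fin n) (Fin n) ℝ)
    (α : Fin m → ℕ) : Matrix (Fin n) (Fin n) ℝ :=
  ∑ β ∈ multiBelow α, b (α - β) * b' β

/-- Truncated Cauchy product: `(b ∗̂ b̃)_α = Σ_{β ≤ α, β ≠ 0, β ≠ α} b_{α−β} b̃_β`. -/
def cauchyProdHat {m n : ℕ} (b b' : (Fin m → ℕ) → Matrix (Fin n) (Fin n) ℝ)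
    (α : Fin m → ℕ) : Matrix (Fin n) (Fin n) ℝ :=
  ∑ β ∈ ((multiBelow α).erase 0).erase α, b (α - β) * b' β

/-- `Res_{i,j}`: the resonance condition `|α| ≥ 1 ∧ α·μ + μⱼ − μᵢ = 0`. -/
def isResonance {m n : ℕ} (hmn : m ≤ n) (μ : Fin n → ℝ) (i j : Fin n)
    (α : Fin m → ℕ) : Prop :=
  1 ≤ multiOrder α ∧ multiDot hmn μ α + μ j - μ i = 0

theorem cauchyProd_zero {m n : ℕ} (b b' : (Fin m → ℕ) → Matrix (Fin n) (Fin n) ℝ) :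
    cauchyProd b b' 0 = b 0 * b' 0 := by
  have h : multiBelow (0 : Fin m → ℕ) = {0} := by
    ext β
    simp [multiBelow, funext_iff]
  simp [cauchyProd, h]

theorem cauchyProd_eq_add_cauchyProdHat {m n : ℕ}
    (b b' : (Fin m → ℕ) → Matrix (Fin n) (Fin n) ℝ) {α : Fin m → ℕ} (hα : α ≠ 0) :
    cauchyProd b b' α = b α * b' 0 + (b 0 * b' α + cauchyProdHat b b' α) := by
  have h0 : (0 : Fin m → ℕ) ∈ multiBelow α := by simp [multiBelow]
  have h1 : α ∈ (multiBelow α).erase 0 := by simp [multiBelow, hα]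
  rw [cauchyProd, cauchyProdHat, ← Finset.add_sum_erase _ _ h0, ← Finset.add_sum_erase _ _ h1,
    tsub_zero, tsub_self]

theorem one_le_multiOrder {m : ℕ} {α : Fin m → ℕ} (hα : α ≠ 0) : 1 ≤ multiOrder α := by
  rw [Nat.one_le_iff_ne_zero]
  intro h
  apply hα
  ext i
  exact Finset.sum_eq_zero_iff.mp h i (Finset.mem_univ i)

theorem multiDot_le_multiOrder_mul {m n : ℕ} (hmn : m ≤ n) (μ : Fin n → ℝ) {c : ℝ}
    (hc : ∀ i : Fin m, μ (Fin.castLE hmn i) ≤ c) (α : Fin m → ℕ) :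
    multiDot hmn μ α ≤ multiOrder α * c := by
  rw [multiDot, multiOrder, Nat.cast_sum, Finset.sum_mul]
  exact Finset.sum_le_sum fun i _ => mul_le_mul_of_nonneg_left (hc i) (Nat.cast_nonneg _)

/-- **Solution of the homological equation in the resonant case (Lemma `L:solve-for-AQ`).**
With `μ₁ < ⋯ < μₘ < 0 < μ_{m+1} < ⋯ < μₙ`, `Ω = diag μ`, `𝒲₀` invertible,
`Ĝ₀ = 𝒲₀ Ω 𝒲₀⁻¹`, and `𝒲, 𝒜` defined by the stated strong recursion (zeroth coefficients
`𝒲₀`, `Ω`; for `|α| ≥ 1`, `S̃_α = 𝒲₀⁻¹(Ĝ_α 𝒲₀ + (Ĝ ∗̂ 𝒲)_α − (𝒲 ∗̂ 𝒜)_α)`, with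
`W̃_α^{i,j} = S̃_α^{i,j}/(α·μ + μⱼ − μᵢ)` off resonance and `0` on resonance,
`𝒜_α^{i,j} = S̃_α^{i,j}` on resonance and `0` otherwise, `𝒲_α = 𝒲₀ W̃_α`), one has:
(a) `(α·μ) 𝒲_α + (𝒲 ∗ 𝒜)_α = (Ĝ ∗ 𝒲)_α` for every `α`;
(b) `𝒜_α^{i,j} = 0` whenever `i > j`;
(c) `𝒜_α^{i,j} = 0` whenever `|α| > (μᵢ − μⱼ)/μₘ`. -/
theorem solve_homological_equation
    {m n : ℕ} (hm : 1 ≤ m) (hmn : m ≤ n)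
    (μ : Fin n → ℝ) (hmono : StrictMono μ)
    (hsign : ∀ i : Fin n, ((i : ℕ) < m → μ i < 0) ∧ (m ≤ (i : ℕ) → 0 < μ i))
    (W0 : Matrix (Fin n) (Fin n) ℝ) (hW0 : IsUnit W0.det)
    (Ghat : (Fin m → ℕ) → Matrix (Fin n) (Fin n) ℝ)
    (hGhat0 : Ghat 0 = W0 * Matrix.diagonal μ * W0⁻¹)
    (𝒲 𝒜 : (Fin m → ℕ) → Matrix (Fin n) (Fin n) ℝ)
    (h𝒲0 : 𝒲 0 = W0) (h𝒜0 : 𝒜 0 = Matrix.diagonal μ)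
    (h𝒲 : ∀ α : Fin m → ℕ, 1 ≤ multiOrder α →
      𝒲 α = W0 * Matrix.of (fun i j =>
        if isResonance hmn μ i j α then 0
        else (W0⁻¹ * (Ghat α * W0 + cauchyProdHat Ghat 𝒲 α - cauchyProdHat 𝒲 𝒜 α)) i j /
          (multiDot hmn μ α + μ j - μ i)))
    (h𝒜 : ∀ α : Fin m → ℕ, 1 ≤ multiOrder α →
      𝒜 α = Matrix.of (fun i j =>
        if isResonance hmn μ i j α then
          (W0⁻¹ * (Ghat α * W0 + cauchyProdHat Ghat 𝒲 α - cauchyProdHat 𝒲 𝒜 α)) i j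
        else 0)) :
    (∀ α : Fin m → ℕ,
        multiDot hmn μ α • 𝒲 α + cauchyProd 𝒲 𝒜 α = cauchyProd Ghat 𝒲 α) ∧
    (∀ (α : Fin m → ℕ) (i j : Fin n), j < i → 𝒜 α i j = 0) ∧
    (∀ (α : Fin m → ℕ) (i j : Fin n),
        (μ i - μ j) / μ (Fin.castLE hmn ⟨m - 1, by omega⟩) < (multiOrder α : ℝ) →
        𝒜 α i j = 0) := by
  set c := μ (Fin.castLE hmn ⟨m - 1, by omega⟩)
  have hc_neg : c < 0 := (hsign _).1 (by simp only [Fin.val_castLE]; omega)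
  have hdot : ∀ α, multiDot hmn μ α ≤ multiOrder α * c :=
    multiDot_le_multiOrder_mul hmn μ fun i => hmono.monotone <| by
      simp only [Fin.le_def, Fin.val_castLE]
      omega
  have h𝒜_zero : ∀ (α : Fin m → ℕ) (i j : Fin n), α ≠ 0 →
      (multiOrder α * c < μ i - μ j) → 𝒜 α i j = 0 := by
    intro α i j hα h
    rw [h𝒜 α (one_le_multiOrder hα), Matrix.of_apply, if_neg]
    rintro ⟨-, hres⟩
    linarith [hdot α]
  refine ⟨fun α => ?_, fun α i j hij => ?_, fun α i j hij => ?_⟩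
  · rcases eq_or_ne α 0 with rfl | hα
    · rw [cauchyProd_zero, cauchyProd_zero, h𝒲0, h𝒜0, hGhat0,
        Matrix.nonsing_inv_mul_cancel_right _ _ hW0]
      simp [multiDot]
    · have hα1 := one_le_multiOrder hα
      rw [cauchyProd_eq_add_cauchyProdHat _ _ hα, cauchyProd_eq_add_cauchyProdHat _ _ hα,
        h𝒲0, h𝒜0, hGhat0]
      have hA := h𝒜 α hα1
      have hW := h𝒲 α hα1
      set S := Ghat α * W0 + cauchyProdHat Ghat 𝒲 α - cauchyProdHat 𝒲 𝒜 α with hS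
      set V : Matrix (Fin n) (Fin n) ℝ := Matrix.of (fun i j =>
        if isResonance hmn μ i j α then 0
        else (W0⁻¹ * S) i j / (multiDot hmn μ α + μ j - μ i))
      have key : multiDot hmn μ α • V + V * Matrix.diagonal μ + 𝒜 α
          = W0⁻¹ * S + Matrix.diagonal μ * V := by
        ext i j
        simp only [hA, V, Matrix.add_apply, Matrix.smul_apply, Matrix.mul_diagonal,
          Matrix.diagonal_mul, Matrix.of_apply, smul_eq_mul]
        split_ifs with h
        · ring
        · have hne : multiDot hmn μ α + μ j - μ i ≠ 0 := fun h0 => h ⟨hα1, h0⟩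
          field_simp
          ring
      have hmul := congrArg (W0 * ·) key
      simp only [mul_add, Matrix.mul_smul, Matrix.mul_nonsing_inv_cancel_left _ _ hW0,
        ← mul_assoc] at hmul
      have hG : W0 * Matrix.diagonal μ * W0⁻¹ * 𝒲 α = W0 * Matrix.diagonal μ * V := by
        rw [hW, ← mul_assoc, Matrix.nonsing_inv_mul_cancel_right _ _ hW0]
      rw [hG, hW]
      rw [← sub_eq_zero] at hmul ⊢
      rw [← hmul, hS]
      abel
  · have hμ := hmono hij
    rcases eq_or_ne α 0 with rfl | hα
    · rw [h𝒜0, Matrix.diagonal_apply_ne _ hij.ne']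
    · have := mul_nonpos_of_nonneg_of_nonpos (Nat.cast_nonneg (α := ℝ) (multiOrder α)) hc_neg.le
      exact h𝒜_zero α i j hα (by linarith)
  · rw [div_lt_iff_of_neg hc_neg] at hij
    rcases eq_or_ne α 0 with rfl | hα
    · rw [h𝒜0, Matrix.diagonal_apply_ne]
      rintro rfl
      simp [multiOrder] at hij
    · exact h𝒜_zero α i j hα hij
end

section
/- Let ρ > 1 and θ ∈ (π/2, π). Define V̌₁ = (e^{−iθ}/ρ, 1, √ρ·e^{iθ/2} + (2/√ρ)e^{−iθ/2}, e^{−iθ/2}/√ρ) ∈ ℂ⁴ and let V̌₂ be its componentwise complex conjugate. Let L ∈ ℝ, let W₁, W₂ : (−∞, −L] → ℂ⁴, and let ε ≥ 0 satisfy ‖W_j(x) − V̌_j‖ ≤ ε‖V̌_j‖ for all x ≤ −L and j = 1, 2 (Euclidean norm on ℂ⁴). If ε < 1/(8ρ^{3/2}), then for every x ≤ −L and every (c₁, c₂) ∈ ℂ², if the first and fourth components of c₁W₁(x) + c₂W₂(x) both vanish, then c₁ = c₂ = 0. -/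
theorem norm_add_mul_sq_le (a b c d : ℂ) :
    ‖a * c + b * d‖ ^ 2 ≤ (‖a‖ ^ 2 + ‖b‖ ^ 2) * (‖c‖ ^ 2 + ‖d‖ ^ 2) := by
  have h : ‖a * c + b * d‖ ≤ ‖a‖ * ‖c‖ + ‖b‖ * ‖d‖ := by
    simpa only [norm_mul] using norm_add_le (a * c) (b * d)
  calc ‖a * c + b * d‖ ^ 2 ≤ (‖a‖ * ‖c‖ + ‖b‖ * ‖d‖) ^ 2 := by gcongr
    _ ≤ _ := by nlinarith [sq_nonneg (‖a‖ * ‖d‖ - ‖b‖ * ‖c‖)]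

/-- A `2 × 2` complex matrix with columns `(a, d)` and `(a', d')` stays injective under column
perturbations `(u, v)` and `(u', v')` that are small compared with its determinant. -/
theorem eq_zero_of_perturbed_columns {a d a' d' u v u' v' c₁ c₂ : ℂ} {F E : ℝ}
    (hF : ‖a‖ ^ 2 + ‖d‖ ^ 2 + ‖a'‖ ^ 2 + ‖d'‖ ^ 2 ≤ F)
    (hE : ‖u‖ ^ 2 + ‖v‖ ^ 2 + ‖u'‖ ^ 2 + ‖v'‖ ^ 2 ≤ E)
    (hdet : F * E < ‖a * d' - a' * d‖ ^ 2)
    (h₀ : c₁ * (a + u) + c₂ * (a' + u') = 0)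
    (h₃ : c₁ * (d + v) + c₂ * (d' + v') = 0) : c₁ = 0 ∧ c₂ = 0 := by
  set p := c₁ * u + c₂ * u' with hp
  set q := c₁ * v + c₂ * v' with hq
  have hpn := norm_add_mul_sq_le c₁ c₂ u u'
  have hqn := norm_add_mul_sq_le c₁ c₂ v v'
  rw [← hp] at hpn
  rw [← hq] at hqn
  have e₁ : (a * d' - a' * d) * c₁ = a' * q + (-d') * p := by
    rw [hp, hq]; linear_combination d' * h₀ - a' * h₃
  have e₂ : (a * d' - a' * d) * c₂ = (-a) * q + d * p := by
    rw [hp, hq]; linear_combination a * h₃ - d * h₀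
  have b₁ := norm_add_mul_sq_le a' (-d') q p
  have b₂ := norm_add_mul_sq_le (-a) d q p
  rw [← e₁, norm_mul, mul_pow, norm_neg] at b₁
  rw [← e₂, norm_mul, mul_pow, norm_neg] at b₂
  set S := ‖c₁‖ ^ 2 + ‖c₂‖ ^ 2 with hS
  have hS0 : 0 ≤ S := by positivity
  have hF0 : 0 ≤ F := le_trans (by positivity) hF
  have hPQ : ‖q‖ ^ 2 + ‖p‖ ^ 2 ≤ S * E := by nlinarith
  have key : ‖a * d' - a' * d‖ ^ 2 * S ≤ F * E * S := by
    calc ‖a * d' - a' * d‖ ^ 2 * S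
        ≤ (‖a‖ ^ 2 + ‖d‖ ^ 2 + ‖a'‖ ^ 2 + ‖d'‖ ^ 2) * (‖q‖ ^ 2 + ‖p‖ ^ 2) := by
          rw [hS]; linarith
      _ ≤ F * (S * E) := by gcongr
      _ = F * E * S := by ring
  have hS_zero : S = 0 := by
    by_contra hne
    have hpos : 0 < S := lt_of_le_of_ne hS0 (Ne.symm hne)
    exact absurd (le_of_mul_le_mul_right key hpos) (not_le.mpr hdet)
  have hc₁ : ‖c₁‖ ^ 2 = 0 := by nlinarith [sq_nonneg ‖c₁‖, sq_nonneg ‖c₂‖]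
  have hc₂ : ‖c₂‖ ^ 2 = 0 := by nlinarith [sq_nonneg ‖c₁‖, sq_nonneg ‖c₂‖]
  exact ⟨by simpa using hc₁, by simpa using hc₂⟩

theorem norm_zero_three_sq_le (v : EuclideanSpace ℂ (Fin 4)) :
    ‖v 0‖ ^ 2 + ‖v 3‖ ^ 2 ≤ ‖v‖ ^ 2 := by
  rw [EuclideanSpace.norm_sq_eq, Fin.sum_univ_four]
  nlinarith [sq_nonneg ‖v 1‖, sq_nonneg ‖v 2‖]

theorem two_le_norm_sub_conj_sq {θ : ℝ} (hθ : Real.cos θ ≤ 0) :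
    2 ≤ ‖Complex.exp (-(θ / 2) * Complex.I) -
      starRingEnd ℂ (Complex.exp (-(θ / 2) * Complex.I))‖ ^ 2 := by
  have him : (Complex.exp (-(θ / 2) * Complex.I)).im = -Real.sin (θ / 2) := by
    have h : (-(θ / 2) * Complex.I : ℂ) = ((-(θ / 2) : ℝ) : ℂ) * Complex.I := by push_cast; ring
    rw [h, Complex.exp_ofReal_mul_I_im, Real.sin_neg]
  rw [Complex.sub_conj, him, norm_mul, Complex.norm_I, mul_one, Complex.norm_real,
    Real.norm_eq_abs, sq_abs]
  have h := Real.sin_sq_eq_half_sub (θ / 2)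
  rw [mul_div_cancel₀ θ two_ne_zero] at h
  nlinarith

/-- **No conjugate points near `−∞` (Proposition `L-_alt`).**
Let `ρ > 1`, `θ ∈ (π/2, π)`, let `V₁` be the stated unstable eigenvector of the asymptotic
matrix and `V₂` its componentwise conjugate. If `‖W_j(x) − V_j‖ ≤ ε ‖V_j‖` for all `x ≤ −L`
and `ε < 1/(8 ρ^{3/2})`, then for `x ≤ −L` any combination `c₁ W₁(x) + c₂ W₂(x)` whose first
and fourth components vanish must be trivial, i.e. `c₁ = c₂ = 0`. -/
theorem no_conjugate_points_near_minus_infinity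
    (ρ θ : ℝ) (hρ : 1 < ρ) (hθ : θ ∈ Set.Ioo (Real.pi / 2) Real.pi)
    (V₁ V₂ : EuclideanSpace ℂ (Fin 4))
    (hV₁ : V₁ = ![Complex.exp (-θ * Complex.I) / ρ, 1,
        (Real.sqrt ρ : ℂ) * Complex.exp (θ / 2 * Complex.I) +
          2 / (Real.sqrt ρ : ℂ) * Complex.exp (-(θ / 2) * Complex.I),
        Complex.exp (-(θ / 2) * Complex.I) / (Real.sqrt ρ : ℂ)])
    (hV₂ : ∀ k, V₂ k = starRingEnd ℂ (V₁ k))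
    (L : ℝ) (W₁ W₂ : ℝ → EuclideanSpace ℂ (Fin 4))
    (ε : ℝ) (hε0 : 0 ≤ ε)
    (h₁ : ∀ x ≤ -L, ‖W₁ x - V₁‖ ≤ ε * ‖V₁‖)
    (h₂ : ∀ x ≤ -L, ‖W₂ x - V₂‖ ≤ ε * ‖V₂‖)
    (hεsmall : ε < 1 / (8 * ρ ^ ((3 : ℝ) / 2))) :
    ∀ x ≤ -L, ∀ c₁ c₂ : ℂ,
      (c₁ • W₁ x + c₂ • W₂ x) 0 = 0 →
      (c₁ • W₁ x + c₂ • W₂ x) 3 = 0 →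
      c₁ = 0 ∧ c₂ = 0 := by
  intro x hx c₁ c₂ h₀ h₃
  have hρ0 : 0 < ρ := by linarith
  set t := Real.sqrt ρ with ht
  have ht0 : 0 < t := Real.sqrt_pos.mpr hρ0
  have ht2 : t ^ 2 = ρ := Real.sq_sqrt hρ0.le
  have hdet := two_le_norm_sub_conj_sq (θ := θ)
    (Real.cos_nonpos_of_pi_div_two_le_of_le hθ.1.le (by linarith [hθ.2, Real.pi_pos]))
  set e := Complex.exp (-(θ / 2) * Complex.I) with he
  have he1 : ‖e‖ = 1 := by
    have h : (-(θ / 2) * Complex.I : ℂ) = ((-(θ / 2) : ℝ) : ℂ) * Complex.I := by push_cast; ring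
    rw [he, h, Complex.norm_exp_ofReal_mul_I]
  have he2 : Complex.exp (-θ * Complex.I) = e ^ 2 := by
    rw [he, ← Complex.exp_nat_mul]; congr 1; push_cast; ring
  have he1' : ‖Complex.exp (θ / 2 * Complex.I)‖ = 1 := by
    have h : (θ / 2 * Complex.I : ℂ) = ((θ / 2 : ℝ) : ℂ) * Complex.I := by push_cast; ring
    rw [h, Complex.norm_exp_ofReal_mul_I]
  have hee : e * starRingEnd ℂ e = 1 := by
    rw [Complex.mul_conj, Complex.normSq_eq_norm_sq, he1]; norm_num
  have v0 : V₁ 0 = e ^ 2 / ρ := by rw [hV₁, ← he2]; rfl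
  have v1 : V₁ 1 = 1 := by rw [hV₁]; rfl
  have v2 : V₁ 2 = (t : ℂ) * Complex.exp (θ / 2 * Complex.I) + 2 / (t : ℂ) * e := by
    rw [hV₁]; rfl
  have v3 : V₁ 3 = e / t := by rw [hV₁]; rfl
  have n0 : ‖V₁ 0‖ ^ 2 = 1 / ρ ^ 2 := by
    rw [v0, norm_div, norm_pow, he1, Complex.norm_real, Real.norm_of_nonneg hρ0.le]; ring
  have n3 : ‖V₁ 3‖ ^ 2 = 1 / ρ := by
    rw [v3, norm_div, he1, Complex.norm_real, Real.norm_of_nonneg ht0.le, div_pow, ht2, one_pow]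
  have n2 : ‖V₁ 2‖ ^ 2 ≤ ρ + 4 + 4 / ρ := by
    have h : ‖V₁ 2‖ ≤ t + 2 / t := by
      rw [v2]
      refine (norm_add_le _ _).trans_eq ?_
      simp [he1, he1', abs_of_pos ht0]
    calc ‖V₁ 2‖ ^ 2 ≤ (t + 2 / t) ^ 2 := by gcongr
      _ = ρ + 4 + 4 / ρ := by rw [← ht2]; field_simp; ring
  have hconj : ∀ k, ‖V₂ k‖ = ‖V₁ k‖ := fun k => by rw [hV₂, Complex.norm_conj]
  have hV : ‖V₁‖ ^ 2 ≤ ρ + 5 + 5 / ρ + 1 / ρ ^ 2 := by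
    rw [EuclideanSpace.norm_sq_eq, Fin.sum_univ_four, n0, v1, n3, norm_one]
    linear_combination n2
  have hV21 : ‖V₂‖ = ‖V₁‖ := by
    rw [EuclideanSpace.norm_eq, EuclideanSpace.norm_eq]; simp only [hconj]
  have hε2 : ε ^ 2 ≤ 1 / (64 * ρ ^ 3) := by
    calc ε ^ 2 ≤ (1 / (8 * ρ ^ ((3 : ℝ) / 2))) ^ 2 := by gcongr
      _ = 1 / (64 * ρ ^ 3) := by
        rw [div_pow, mul_pow, ← Real.rpow_mul_natCast hρ0.le]
        norm_num
  have d₁ : ‖(W₁ x - V₁) 0‖ ^ 2 + ‖(W₁ x - V₁) 3‖ ^ 2 ≤ ε ^ 2 * ‖V₁‖ ^ 2 := by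
    refine (norm_zero_three_sq_le _).trans ?_
    rw [← mul_pow]
    exact pow_le_pow_left₀ (norm_nonneg _) (h₁ x hx) 2
  have d₂ : ‖(W₂ x - V₂) 0‖ ^ 2 + ‖(W₂ x - V₂) 3‖ ^ 2 ≤ ε ^ 2 * ‖V₁‖ ^ 2 := by
    refine (norm_zero_three_sq_le _).trans ?_
    rw [← mul_pow, ← hV21]
    exact pow_le_pow_left₀ (norm_nonneg _) (h₂ x hx) 2
  refine eq_zero_of_perturbed_columns (a := V₁ 0) (d := V₁ 3) (a' := V₂ 0) (d' := V₂ 3)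
    (u := (W₁ x - V₁) 0) (v := (W₁ x - V₁) 3) (u' := (W₂ x - V₂) 0) (v' := (W₂ x - V₂) 3)
    (F := 2 * (1 / ρ ^ 2 + 1 / ρ))
    (E := 2 * (1 / (64 * ρ ^ 3) * (ρ + 5 + 5 / ρ + 1 / ρ ^ 2))) ?_ ?_ ?_ ?_ ?_
  · rw [hconj, hconj, n0, n3]
    exact le_of_eq (by ring)
  · have : ε ^ 2 * ‖V₁‖ ^ 2 ≤ 1 / (64 * ρ ^ 3) * (ρ + 5 + 5 / ρ + 1 / ρ ^ 2) := by gcongr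
    linarith
  · have hD : V₁ 0 * V₂ 3 - V₂ 0 * V₁ 3 = (e - starRingEnd ℂ e) / (ρ * t) := by
      rw [hV₂, hV₂, v0, v3]
      simp only [map_div₀, map_pow, Complex.conj_ofReal]
      have h1 : (ρ : ℂ) ≠ 0 := by exact_mod_cast hρ0.ne'
      have h2 : (t : ℂ) ≠ 0 := by exact_mod_cast ht0.ne'
      field_simp
      linear_combination (e - starRingEnd ℂ e) * hee
    have hN : ‖V₁ 0 * V₂ 3 - V₂ 0 * V₁ 3‖ ^ 2 = ‖e - starRingEnd ℂ e‖ ^ 2 / ρ ^ 3 := by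
      rw [hD, norm_div, norm_mul, Complex.norm_real, Complex.norm_real,
        Real.norm_of_nonneg hρ0.le, Real.norm_of_nonneg ht0.le, div_pow, mul_pow, ht2]
      ring
    rw [hN]
    refine lt_of_lt_of_le ?_ (div_le_div_of_nonneg_right hdet (by positivity))
    obtain ⟨r, hr⟩ : ∃ r, r = 1 / ρ := ⟨_, rfl⟩
    have hr0 : 0 < r := by rw [hr]; positivity
    have hr1 : r ≤ 1 := by rw [hr, div_le_one hρ0]; exact hρ.le
    have hr2 : r ^ 2 ≤ 1 := pow_le_one₀ hr0.le hr1
    have hr3 : r ^ 3 ≤ 1 := pow_le_one₀ hr0.le hr1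
    have hL : 2 * (1 / ρ ^ 2 + 1 / ρ) * (2 * (1 / (64 * ρ ^ 3) * (ρ + 5 + 5 / ρ + 1 / ρ ^ 2)))
        = (1 + r) * (1 + 5 * r + 5 * r ^ 2 + r ^ 3) / 16 / ρ ^ 3 := by
      rw [hr]; field_simp; ring
    rw [hL]
    refine div_lt_div_of_pos_right ?_ (by positivity)
    have : (1 + r) * (1 + 5 * r + 5 * r ^ 2 + r ^ 3) ≤ 2 * 12 := by
      gcongr <;> linarith
    linarith
  · simpa using h₀
  · simpa using h₃
end

section
/- Let ρ > 0 and θ ∈ (π/2, π). Set μ₁ = −√ρ·e^{iθ/2}, μ₂ = −√ρ·e^{−iθ/2}, μ₃ = √ρ·e^{iθ/2}, μ₄ = √ρ·e^{−iθ/2}. Then for (i, j) ∈ {1,2,3,4}² and α = (α₁, α₂) ∈ ℕ² with α₁ + α₂ ≥ 1, the resonance equation α₁μ₁ + α₂μ₂ + μⱼ − μᵢ = 0 holds if and only if (i, j, α) is one of the four triples (1, 3, (2,0)), (1, 4, (1,1)), (2, 3, (1,1)), (2, 4, (0,2)). -/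
/-- A complex number off both coordinate axes and its conjugate are linearly independent
over the integers. -/
theorem intCast_mul_add_intCast_mul_conj_eq_zero_iff {z : ℂ} (hre : z.re ≠ 0) (him : z.im ≠ 0)
    (m n : ℤ) : (m : ℂ) * z + (n : ℂ) * starRingEnd ℂ z = 0 ↔ m = 0 ∧ n = 0 := by
  refine ⟨fun h => ?_, by rintro ⟨rfl, rfl⟩; simp⟩
  have h_sum : ((m + n : ℤ) : ℝ) * z.re = 0 := by
    have := congrArg Complex.re h
    simp at this
    push_cast
    linarith
  have h_diff : ((m - n : ℤ) : ℝ) * z.im = 0 := by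
    have := congrArg Complex.im h
    simp at this
    push_cast
    linarith
  have hmn : m + n = 0 := by exact_mod_cast (mul_eq_zero.mp h_sum).resolve_right hre
  have hmn' : m - n = 0 := by exact_mod_cast (mul_eq_zero.mp h_diff).resolve_right him
  omega

/-- **Enumeration of the Swift–Hohenberg vector-bundle resonances.**
For the eigenvalue quartet `μ₁ = −√ρ e^{iθ/2}`, `μ₂ = −√ρ e^{−iθ/2}`, `μ₃ = √ρ e^{iθ/2}`,
`μ₄ = √ρ e^{−iθ/2}` (here indexed by `Fin 4` as `0,1,2,3`), and any multi-index
`α = (α₁, α₂) ∈ ℕ²` with `|α| ≥ 1`, the resonance equation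
`α₁μ₁ + α₂μ₂ + μⱼ − μᵢ = 0` holds exactly for the four triples
`(i,j,α) ∈ {(1,3,(2,0)), (1,4,(1,1)), (2,3,(1,1)), (2,4,(0,2))}` (in `1`-based indexing). -/
theorem swift_hohenberg_resonances (ρ θ : ℝ) (hρ : 0 < ρ)
    (hθ : θ ∈ Set.Ioo (Real.pi / 2) Real.pi)
    (μ : Fin 4 → ℂ)
    (hμ : μ = ![-((Real.sqrt ρ : ℂ) * Complex.exp (θ / 2 * Complex.I)),
                -((Real.sqrt ρ : ℂ) * Complex.exp (-(θ / 2) * Complex.I)),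
                (Real.sqrt ρ : ℂ) * Complex.exp (θ / 2 * Complex.I),
                (Real.sqrt ρ : ℂ) * Complex.exp (-(θ / 2) * Complex.I)]) :
    ∀ (i j : Fin 4) (a₁ a₂ : ℕ), 1 ≤ a₁ + a₂ →
      ((a₁ : ℂ) * μ 0 + (a₂ : ℂ) * μ 1 + μ j - μ i = 0 ↔
        ((i, j, a₁, a₂) = ((0 : Fin 4), (2 : Fin 4), 2, 0) ∨
         (i, j, a₁, a₂) = ((0 : Fin 4), (3 : Fin 4), 1, 1) ∨
         (i, j, a₁, a₂) = ((1 : Fin 4), (2 : Fin 4), 1, 1) ∨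
         (i, j, a₁, a₂) = ((1 : Fin 4), (3 : Fin 4), 0, 2))) := by
  obtain ⟨hθ₁, hθ₂⟩ := hθ
  have hπ := Real.pi_pos
  have hsqrt : 0 < √ρ := Real.sqrt_pos.mpr hρ
  have hcos : 0 < Real.cos (θ / 2) := Real.cos_pos_of_mem_Ioo ⟨by linarith, by linarith⟩
  have hsin : 0 < Real.sin (θ / 2) := Real.sin_pos_of_pos_of_lt_pi (by linarith) (by linarith)
  obtain ⟨z, hz⟩ : ∃ z : ℂ, z = (√ρ : ℂ) * Complex.exp (θ / 2 * Complex.I) := ⟨_, rfl⟩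
  have hz_conj : (√ρ : ℂ) * Complex.exp (-(θ / 2) * Complex.I) = starRingEnd ℂ z := by
    simp [hz, ← Complex.exp_conj, Complex.conj_ofNat]
  have hz_polar : z = (√ρ : ℂ) * Complex.exp ((θ / 2 : ℝ) * Complex.I) := by simp [hz]
  have hre : z.re ≠ 0 := by
    rw [hz_polar, Complex.re_ofReal_mul, Complex.exp_ofReal_mul_I_re]
    positivity
  have him : z.im ≠ 0 := by
    rw [hz_polar, Complex.im_ofReal_mul, Complex.exp_ofReal_mul_I_im]
    positivity
  rw [hz_conj, ← hz] at hμ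
  subst hμ
  intro i j a₁ a₂ ha
  -- The coefficients of the eigenvalues with respect to `z` and its conjugate.
  let c : Fin 4 → ℤ := ![-1, 0, 1, 0]
  let d : Fin 4 → ℤ := ![0, -1, 0, 1]
  have key := intCast_mul_add_intCast_mul_conj_eq_zero_iff hre him
    (-a₁ + c j - c i) (-a₂ + d j - d i)
  trans (-a₁ + c j - c i = 0 ∧ -a₂ + d j - d i = 0)
  · rw [← key]
    refine Eq.congr ?_ rfl
    fin_cases i <;> fin_cases j <;> simp [c, d] <;> ring
  · fin_cases i <;> fin_cases j <;> simp [c, d] <;> omega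
end

section
/- Define h : ℝ → ℝ by h(u) = u(2u − 1)(1 − u), so h'(u) = −6u² + 6u − 1, and define φ₋(x) = 1/(1 + e^{−x}). Then both of the following functions are twice differentiable and satisfy the variational equation v''(x) + h'(φ₋(x))·v(x) = 0 for all x ∈ ℝ: (a) vˢ(x) = φ₋'(x) = e^{−x}/(1 + e^{−x})²; (b) ṽᵘ(x) = (e^{x} + 8 − 8e^{−2x} − e^{−3x} + 12x·e^{−x})/(1 + e^{−x})². -/
/-- Reduction of order: if `v'' = q v` and `w' = c / v²` with `v` nowhere zero, then `v w` is a
solution of the same equation. -/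
theorem hasDerivAt_reduction_of_order {v v₁ q w : ℝ → ℝ} {c : ℝ} (hv₀ : ∀ x, v x ≠ 0)
    (hv : ∀ x, HasDerivAt v (v₁ x) x) (hv₁ : ∀ x, HasDerivAt v₁ (q x * v x) x)
    (hw : ∀ x, HasDerivAt w (c / v x ^ 2) x) :
    (∀ x, HasDerivAt (fun y => v y * w y) (v₁ x * w x + c / v x) x) ∧
      ∀ x, HasDerivAt (fun y => v₁ y * w y + c / v y) (q x * (v x * w x)) x := by
  refine ⟨fun x => ?_, fun x => ?_⟩
  · have hx := hv₀ x
    refine ((hv x).fun_mul (hw x)).congr_deriv ?_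
    field_simp
  · have hx := hv₀ x
    refine (((hv₁ x).fun_mul (hw x)).fun_add
      ((hasDerivAt_const x c).fun_div (hv x) hx)).congr_deriv ?_
    field_simp
    ring

theorem differentiableAt_and_deriv_deriv_add_eq_zero {v v₁ q : ℝ → ℝ}
    (hv : ∀ x, HasDerivAt v (v₁ x) x) (hv₁ : ∀ x, HasDerivAt v₁ (-q x * v x) x) :
    (∀ x, DifferentiableAt ℝ v x) ∧ (∀ x, DifferentiableAt ℝ (deriv v) x) ∧
      ∀ x, deriv (deriv v) x + q x * v x = 0 := by
  have hd : deriv v = v₁ := funext fun x => (hv x).deriv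
  rw [hd]
  refine ⟨fun x => (hv x).differentiableAt, fun x => (hv₁ x).differentiableAt, fun x => ?_⟩
  rw [(hv₁ x).deriv]
  ring

/-- **Explicit stable and unstable solutions of the bistable variational equation.**
With `h'(u) = −6u² + 6u − 1` and `φ₋(x) = 1/(1+e^{−x})`, both
`vˢ(x) = φ₋'(x) = e^{−x}/(1+e^{−x})²` and
`ṽᵘ(x) = (e^{x} + 8 − 8e^{−2x} − e^{−3x} + 12x e^{−x})/(1+e^{−x})²`
are twice differentiable and satisfy `v'' + h'(φ₋) v = 0`. -/
theorem bistable_variational_solutions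
    (h' : ℝ → ℝ) (hh' : ∀ u, h' u = -6 * u ^ 2 + 6 * u - 1)
    (φm vs vu : ℝ → ℝ)
    (hφm : ∀ x, φm x = 1 / (1 + Real.exp (-x)))
    (hvs : ∀ x, vs x = Real.exp (-x) / (1 + Real.exp (-x)) ^ 2)
    (hvu : ∀ x, vu x = (Real.exp x + 8 - 8 * Real.exp (-(2 * x)) - Real.exp (-(3 * x))
        + 12 * x * Real.exp (-x)) / (1 + Real.exp (-x)) ^ 2) :
    ((∀ x, deriv φm x = vs x) ∧
     (∀ x, DifferentiableAt ℝ vs x) ∧ (∀ x, DifferentiableAt ℝ (deriv vs) x) ∧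
     (∀ x, deriv (deriv vs) x + h' (φm x) * vs x = 0)) ∧
    ((∀ x, DifferentiableAt ℝ vu x) ∧ (∀ x, DifferentiableAt ℝ (deriv vu) x) ∧
     (∀ x, deriv (deriv vu) x + h' (φm x) * vu x = 0)) := by
  have hpos : ∀ x : ℝ, 1 + Real.exp (-x) ≠ 0 := fun x => by positivity
  have hexp : ∀ x : ℝ, HasDerivAt (fun y : ℝ => Real.exp (-y)) (-Real.exp (-x)) x := fun x => by
    simpa using (hasDerivAt_neg x).exp
  have hvs₀ : ∀ x, vs x ≠ 0 := fun x => by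
    rw [hvs]
    positivity
  have hvsφ : ∀ x, vs x = φm x * (1 - φm x) := fun x => by
    have := hpos x
    rw [hvs, hφm]
    field_simp
    ring
  have dφ : ∀ x, HasDerivAt φm (vs x) x := fun x => by
    rw [funext hφm, hvs]
    refine ((hasDerivAt_const x (1 : ℝ)).fun_div ((hexp x).const_add 1) (hpos x)).congr_deriv ?_
    ring
  have dvs : ∀ x, HasDerivAt vs (vs x * (1 - 2 * φm x)) x := fun x => by
    have h := (dφ x).fun_mul ((dφ x).const_sub 1)
    rw [← funext hvsφ] at h
    exact h.congr_deriv (by ring)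
  have dvs₁ : ∀ x, HasDerivAt (fun y => vs y * (1 - 2 * φm y)) (-h' (φm x) * vs x) x := fun x => by
    refine ((dvs x).fun_mul (((dφ x).const_mul 2).const_sub 1)).congr_deriv ?_
    rw [hh', hvsφ]
    ring
  let w : ℝ → ℝ := fun x =>
    Real.exp x ^ 2 + 8 * Real.exp x + 12 * x - 8 * Real.exp (-x) - Real.exp (-x) ^ 2
  have dw : ∀ x, HasDerivAt w (2 / vs x ^ 2) x := fun x => by
    have h := ((((((Real.hasDerivAt_exp x).fun_pow 2).fun_add
      ((Real.hasDerivAt_exp x).const_mul 8)).fun_add ((hasDerivAt_id' x).const_mul 12)).fun_sub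
      ((hexp x).const_mul 8)).fun_sub ((hexp x).fun_pow 2))
    refine h.congr_deriv ?_
    have := hpos x
    simp only [hvs, Real.exp_neg, Nat.reduceSub, pow_one, Nat.cast_ofNat] at this ⊢
    field_simp
    ring
  have hvuw : vu = fun x => vs x * w x := funext fun x => by
    have := hpos x
    have h₂ : Real.exp (-(2 * x)) = Real.exp (-x) ^ 2 := by
      rw [← Real.exp_nat_mul]
      congr 1
      push_cast
      ring
    have h₃ : Real.exp (-(3 * x)) = Real.exp (-x) ^ 3 := by
      rw [← Real.exp_nat_mul]
      congr 1
      push_cast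
      ring
    simp only [hvu, hvs, w, h₂, h₃]
    rw [Real.exp_neg] at this ⊢
    field_simp
    ring
  obtain ⟨dvu, dvu₁⟩ := hasDerivAt_reduction_of_order hvs₀ dvs dvs₁ dw
  refine ⟨⟨fun x => (dφ x).deriv, differentiableAt_and_deriv_deriv_add_eq_zero dvs dvs₁⟩, ?_⟩
  rw [hvuw]
  exact differentiableAt_and_deriv_deriv_add_eq_zero dvu dvu₁
end

section
/- Fix k ∈ ℝ and for σ ∈ (−1, ∞) define Wˢ(σ) = (−1/(1+σ)², (1−σ)/(1+σ)³) ∈ ℝ², Wᵘ(σ) = ((1 + 8σ − 8σ³ − σ⁴)/(1+σ)² + k·σ²/(1+σ)², (1 + 3σ + 28σ² + 28σ³ + 3σ⁴ + σ⁵)/(1+σ)³ + k·σ²·(σ−1)/(1+σ)³) ∈ ℝ², and let 𝒲(σ) be the 2×2 matrix with columns Wˢ(σ) and Wᵘ(σ). Let A(σ) be the 2×2 matrix with rows (−1, −12σ²) and (0, 1), and let D(σ) be the 2×2 matrix with rows (0, 1) and ((σ² − 4σ + 1)/(1+σ)², 0). Then 𝒲 is differentiable on (−1, ∞) and for every σ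 ∈ (−1, ∞), D(σ)·𝒲(σ) = −σ·𝒲'(σ) + 𝒲(σ)·A(σ), where 𝒲'(σ) is the entrywise derivative. -/
/-- Stable bundle of the bistable stable manifold. -/
noncomputable def bistableW11 : ℝ → ℝ := fun σ => -1 / (1 + σ) ^ 2

noncomputable def bistableW21 : ℝ → ℝ := fun σ => (1 - σ) / (1 + σ) ^ 3

/-- Analytic (non-invariant) unstable bundle, first component, with free parameter `k`. -/
noncomputable def bistableW12 (k : ℝ) : ℝ → ℝ := fun σ =>
  (1 + 8 * σ - 8 * σ ^ 3 - σ ^ 4) / (1 + σ) ^ 2 + k * σ ^ 2 / (1 + σ) ^ 2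

noncomputable def bistableW22 (k : ℝ) : ℝ → ℝ := fun σ =>
  (1 + 3 * σ + 28 * σ ^ 2 + 28 * σ ^ 3 + 3 * σ ^ 4 + σ ^ 5) / (1 + σ) ^ 3
    + k * σ ^ 2 * (σ - 1) / (1 + σ) ^ 3

theorem hasDerivAt_bistableW11 {σ : ℝ} (h : 1 + σ ≠ 0) :
    HasDerivAt bistableW11 (2 / (1 + σ) ^ 3) σ := by
  have hd : HasDerivAt (fun x : ℝ => 1 + x) 1 σ := (hasDerivAt_id' σ).const_add 1
  refine ((hasDerivAt_const σ (-1 : ℝ)).fun_div (hd.fun_pow 2) (pow_ne_zero 2 h)).congr_deriv ?_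
  field_simp
  ring

theorem hasDerivAt_bistableW21 {σ : ℝ} (h : 1 + σ ≠ 0) :
    HasDerivAt bistableW21 ((2 * σ - 4) / (1 + σ) ^ 4) σ := by
  have hd : HasDerivAt (fun x : ℝ => 1 + x) 1 σ := (hasDerivAt_id' σ).const_add 1
  refine (((hasDerivAt_id' σ).const_sub 1).fun_div (hd.fun_pow 3)
    (pow_ne_zero 3 h)).congr_deriv ?_
  field_simp
  ring

theorem hasDerivAt_bistableW12 (k : ℝ) {σ : ℝ} (h : 1 + σ ≠ 0) :
    HasDerivAt (bistableW12 k)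
      (((8 - 24 * σ ^ 2 - 4 * σ ^ 3) * (1 + σ) - 2 * (1 + 8 * σ - 8 * σ ^ 3 - σ ^ 4)
        + 2 * k * σ) / (1 + σ) ^ 3) σ := by
  have hx := hasDerivAt_id' σ
  have hd : HasDerivAt (fun x : ℝ => 1 + x) 1 σ := hx.const_add 1
  have hp := hd.fun_pow 2
  have h0 := pow_ne_zero 2 h
  refine ((((((hx.const_mul 8).const_add 1).fun_sub ((hx.fun_pow 3).const_mul 8)).fun_sub
    (hx.fun_pow 4)).fun_div hp h0).fun_add
      (((hx.fun_pow 2).const_mul k).fun_div hp h0)).congr_deriv ?_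
  field_simp
  ring

theorem hasDerivAt_bistableW22 (k : ℝ) {σ : ℝ} (h : 1 + σ ≠ 0) :
    HasDerivAt (bistableW22 k)
      (((3 + 56 * σ + 84 * σ ^ 2 + 12 * σ ^ 3 + 5 * σ ^ 4 + k * (3 * σ ^ 2 - 2 * σ)) * (1 + σ)
        - 3 * (1 + 3 * σ + 28 * σ ^ 2 + 28 * σ ^ 3 + 3 * σ ^ 4 + σ ^ 5
          + k * σ ^ 2 * (σ - 1))) / (1 + σ) ^ 4) σ := by
  have hx := hasDerivAt_id' σ
  have hd : HasDerivAt (fun x : ℝ => 1 + x) 1 σ := hx.const_add 1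
  have hp := hd.fun_pow 3
  have h0 := pow_ne_zero 3 h
  refine (((((((hx.const_mul 3).const_add 1).fun_add ((hx.fun_pow 2).const_mul 28)).fun_add
    ((hx.fun_pow 3).const_mul 28)).fun_add ((hx.fun_pow 4).const_mul 3)).fun_add
      (hx.fun_pow 5)).fun_div hp h0).fun_add
        ((((hx.fun_pow 2).const_mul k).fun_mul (hx.sub_const 1)).fun_div hp h0)
          |>.congr_deriv ?_
  field_simp
  ring

/-- **Closed-form verification of the resonant bundle conjugacy equation for the
bistable equation**: with `𝒲(σ) = [Wˢ(σ) | Wᵘ(σ)]`, `𝒜(σ) = [[−1, −12σ²],[0,1]]` and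
`D(σ) = DG(P(σ))`, one has `D(σ)𝒲(σ) = −σ 𝒲'(σ) + 𝒲(σ)𝒜(σ)` for all `σ > −1`. -/
theorem bistable_bundle_conjugacy (k : ℝ) :
    (∀ σ ∈ Set.Ioi (-1 : ℝ),
      DifferentiableAt ℝ bistableW11 σ ∧ DifferentiableAt ℝ (bistableW12 k) σ ∧
      DifferentiableAt ℝ bistableW21 σ ∧ DifferentiableAt ℝ (bistableW22 k) σ) ∧
    (∀ σ ∈ Set.Ioi (-1 : ℝ),
      (!![0, 1; (σ ^ 2 - 4 * σ + 1) / (1 + σ) ^ 2, 0] : Matrix (Fin 2) (Fin 2) ℝ) *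
          !![bistableW11 σ, bistableW12 k σ; bistableW21 σ, bistableW22 k σ] =
        (-σ) • !![deriv bistableW11 σ, deriv (bistableW12 k) σ;
                  deriv bistableW21 σ, deriv (bistableW22 k) σ] +
          !![bistableW11 σ, bistableW12 k σ; bistableW21 σ, bistableW22 k σ] *
            !![-1, -12 * σ ^ 2; 0, 1]) := by
  have hne {σ : ℝ} (hσ : σ ∈ Set.Ioi (-1 : ℝ)) : 1 + σ ≠ 0 := by
    have := Set.mem_Ioi.mp hσ
    linarith
  refine ⟨fun σ hσ => ?_, fun σ hσ => ?_⟩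
  · have h := hne hσ
    exact ⟨(hasDerivAt_bistableW11 h).differentiableAt,
      (hasDerivAt_bistableW12 k h).differentiableAt,
      (hasDerivAt_bistableW21 h).differentiableAt,
      (hasDerivAt_bistableW22 k h).differentiableAt⟩
  · have h := hne hσ
    rw [(hasDerivAt_bistableW11 h).deriv, (hasDerivAt_bistableW12 k h).deriv,
      (hasDerivAt_bistableW21 h).deriv, (hasDerivAt_bistableW22 k h).deriv]
    ext i j
    fin_cases i <;> fin_cases j <;>
      simp [Matrix.mul_apply, Fin.sum_univ_two, bistableW11, bistableW12, bistableW21,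
        bistableW22] <;>
      field_simp <;> ring
end
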